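/- arXiv:2506.05615 — 2 statements merged into one kernel-verified Lean document; each statement's English description precedes it below -/
import Mathlib

section
/- Let (A, μ) be a measure space, let π : A → ℝ be a measurable probability density with respect to μ (π ≥ 0 and ∫ π dμ = 1) with π(a) > 0 for μ-a.e. a such that a ↦ π(a) · log π(a) is μ-integrable, and let α > 0 and v ∈ ℝ. Then there exists a measurable function Q : A → ℝ such that (i) Z = ∫ exp(Q(a)/α) dμ(a) is finite and positive and the Boltzmann density a ↦ exp(Q(a)/α)/Z equals π μ-almost everywhere, and (ii) ∫ π(a) Q(a) dμ(a) + α H(π) = v, where H(π) = -∫ π(a) log π(a) dμ(a). -/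
open MeasureTheory Real

/-- Backward Compatibility Lemma (Lemma 5.2): for an arbitrary target policy
density `p` (with `p * log p` integrable) and an arbitrary desired soft value
`v`, there exists a measurable Q-landscape `Q` such that (i) the partition
function `Z = ∫ exp (Q a / α) dμ` is finite (the integrand is integrable) and
positive, and the Boltzmann density `a ↦ exp (Q a / α) / Z` equals `p`
μ-almost everywhere, and (ii) the soft value satisfies
`∫ p a * Q a dμ + α * H(p) = v` where `H(p) = -∫ p a * log (p a) dμ`. -/
theorem stmt_2 {A : Type*} [MeasurableSpace A] (μ : Measure A)
    (p : A → ℝ) (hpm : Measurable p) (hp0 : ∀ a, 0 ≤ p a)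
    (hp1 : ∫ a, p a ∂μ = 1) (hppos : ∀ᵐ a ∂μ, 0 < p a)
    (hint : Integrable (fun a => p a * Real.log (p a)) μ)
    (α : ℝ) (hα : 0 < α) (v : ℝ) :
    ∃ Q : A → ℝ, Measurable Q ∧
      Integrable (fun a => Real.exp (Q a / α)) μ ∧
      0 < ∫ a, Real.exp (Q a / α) ∂μ ∧
      ((fun a => Real.exp (Q a / α) / (∫ a, Real.exp (Q a / α) ∂μ)) =ᵐ[μ] p) ∧
      (∫ a, p a * Q a ∂μ) + α * (-∫ a, p a * Real.log (p a) ∂μ) = v := by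
  have hpint : Integrable p μ := by
    by_contra h
    simp [integral_undef h] at hp1
  have hexp : (fun a => Real.exp ((α * Real.log (p a) + v) / α)) =ᵐ[μ]
      fun a => p a * Real.exp (v / α) := by
    filter_upwards [hppos] with a ha
    rw [add_div, mul_div_cancel_left₀ _ hα.ne', Real.exp_add, Real.exp_log ha]
  have hZ : ∫ a, Real.exp ((α * Real.log (p a) + v) / α) ∂μ = Real.exp (v / α) := by
    rw [integral_congr_ae hexp, integral_mul_const, hp1, one_mul]
  refine ⟨fun a => α * Real.log (p a) + v, by fun_prop,
    (hpint.mul_const _).congr hexp.symm, ?_, ?_, ?_⟩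
  · rw [hZ]
    exact Real.exp_pos _
  · filter_upwards [hexp] with a ha
    rw [hZ, ha, mul_div_cancel_right₀ _ (Real.exp_ne_zero _)]
  · have hQ : (fun a => p a * (α * Real.log (p a) + v)) =
        fun a => α * (p a * Real.log (p a)) + p a * v := by
      ext a
      ring
    rw [hQ, integral_add (hint.const_mul α) (hpint.mul_const v), integral_const_mul,
      integral_mul_const, hp1]
    ring
end

section
/- Let Q_g : ℝ → ℝ be defined by Q_g(a) = 1 if |a| ≤ 0.1 and Q_g(a) = -20 otherwise, and let Q_b : ℝ → ℝ be the constant function -1. Then ∫_{[-1,1]} exp(Q_g(a)) da = 0.2·e + 1.8·e^{-20}, ∫_{[-1,1]} exp(Q_b(a)) da = 2·e^{-1}, and ∫_{[-1,1]} exp(Q_g(a)) da < ∫_{[-1,1]} exp(Q_b(a)) da; consequently, for every γ > 0, γ · log ∫_{[-1,1]} exp(Q_g(a)) da < γ · log ∫_{[-1,1]} exp(Q_b(a)) da. -/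
open MeasureTheory Real

theorem setIntegral_Icc_ite_abs_le {r R : ℝ} (hr : 0 ≤ r) (hrR : r ≤ R) (c d : ℝ) :
    ∫ a in Set.Icc (-R) R, (if |a| ≤ r then c else d) = 2 * r * c + 2 * (R - r) * d := by
  have hfun : (fun a : ℝ => if |a| ≤ r then c else d) =
      fun a => d + (Set.Icc (-r) r).indicator (fun _ => c - d) a := by
    funext a
    by_cases ha : |a| ≤ r
    · simp [ha, Set.indicator, abs_le.mp ha]
    · have ha' : a ∉ Set.Icc (-r) r := fun h => ha (abs_le.mpr h)
      simp [ha, Set.indicator_of_notMem ha']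
  have hsub : Set.Icc (-R) R ∩ Set.Icc (-r) r = Set.Icc (-r) r :=
    Set.inter_eq_right.mpr (Set.Icc_subset_Icc (neg_le_neg hrR) hrR)
  have hind : Integrable ((Set.Icc (-r) r).indicator fun _ => c - d)
      (volume.restrict (Set.Icc (-R) R)) :=
    (integrable_const _).indicator measurableSet_Icc
  rw [hfun, integral_add (integrable_const _) hind, setIntegral_indicator measurableSet_Icc, hsub,
    setIntegral_const, setIntegral_const, Real.volume_real_Icc_of_le (by linarith),
    Real.volume_real_Icc_of_le (by linarith), smul_eq_mul, smul_eq_mul]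
  ring

theorem exp_partition_bound :
    0.2 * Real.exp 1 + 1.8 * Real.exp (-20) < 2 * Real.exp (-1) := by
  have hinv : Real.exp (-1) * Real.exp 1 = 1 := by rw [← Real.exp_add]; simp
  have hlow : 0.36 < Real.exp (-1) := by
    nlinarith [Real.exp_one_lt_d9, Real.exp_pos (-1)]
  have hsmall : Real.exp (-20) < 0.05 := by
    have h : Real.exp (-20) * Real.exp 20 = 1 := by rw [← Real.exp_add]; simp
    nlinarith [Real.add_one_le_exp (20 : ℝ), Real.exp_pos (-20)]
  linarith [Real.exp_one_lt_d9]

/-- Soft-Q computation in the toy MDP (α = 1): the good state's Q-landscape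
`Q_g` (value 1 on |a| ≤ 0.1, value -20 elsewhere) has a strictly smaller
partition function over [-1,1] than the bad state's constant landscape
`Q_b = -1`, so for every discount `γ > 0` the soft Q-value of the good branch
`γ * log ∫ exp Q_g` is strictly smaller than that of the bad branch. -/
theorem stmt_7 (Q_g Q_b : ℝ → ℝ)
    (hg : ∀ a, Q_g a = if |a| ≤ 0.1 then 1 else -20)
    (hb : ∀ a, Q_b a = -1) :
    (∫ a in Set.Icc (-1 : ℝ) 1, Real.exp (Q_g a) = 0.2 * Real.exp 1 + 1.8 * Real.exp (-20)) ∧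
    (∫ a in Set.Icc (-1 : ℝ) 1, Real.exp (Q_b a) = 2 * Real.exp (-1)) ∧
    (∫ a in Set.Icc (-1 : ℝ) 1, Real.exp (Q_g a)) < (∫ a in Set.Icc (-1 : ℝ) 1, Real.exp (Q_b a)) ∧
    ∀ γ : ℝ, 0 < γ →
      γ * Real.log (∫ a in Set.Icc (-1 : ℝ) 1, Real.exp (Q_g a)) <
      γ * Real.log (∫ a in Set.Icc (-1 : ℝ) 1, Real.exp (Q_b a)) := by
  have hIg : ∫ a in Set.Icc (-1 : ℝ) 1, Real.exp (Q_g a) =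
      0.2 * Real.exp 1 + 1.8 * Real.exp (-20) := by
    simp only [hg, apply_ite Real.exp]
    rw [setIntegral_Icc_ite_abs_le (by norm_num) (by norm_num)]
    ring
  have hIb : ∫ a in Set.Icc (-1 : ℝ) 1, Real.exp (Q_b a) = 2 * Real.exp (-1) := by
    simp only [hb]
    rw [setIntegral_const, Real.volume_real_Icc_of_le (by norm_num), smul_eq_mul]
    ring
  refine ⟨hIg, hIb, ?_, fun γ hγ => ?_⟩
  · rw [hIg, hIb]
    exact exp_partition_bound
  · rw [hIg, hIb]
    exact mul_lt_mul_of_pos_left (Real.log_lt_log (by positivity) exp_partition_bound) hγ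
end
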